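/- arXiv:2405.05898 — 3 statements merged into one kernel-verified Lean document; each statement's English description precedes it below -/
import Mathlib

section
/- In the approximation setting, assume q* := ‖(T − T_h) ∘ G‖_{L(Γ,X)} · ‖Â⁻¹‖_{L(Δ,Γ)} < 1 (so that K̂ is bijective). Then K̂⁻¹(Z × X_h) ⊆ Q × X_h, and for every F_B ∈ Z and F ∈ Y the approximate problem has a unique solution (x_h, U_h) ∈ Q × X; moreover this solution satisfies U_h ∈ X_h. -/
/-- A perturbation of an invertible operator `e` by `P` is bijective when `‖P‖ * ‖e⁻¹‖ < 1`. -/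
theorem ContinuousLinearEquiv.bijective_add_of_norm_mul_lt_one {𝕜 E F : Type*}
    [NontriviallyNormedField 𝕜] [NormedAddCommGroup E] [NormedSpace 𝕜 E]
    [NormedAddCommGroup F] [NormedSpace 𝕜 F] [CompleteSpace F]
    (e : E ≃L[𝕜] F) (P : E →L[𝕜] F)
    (h : ‖P‖ * ‖(e.symm : F →L[𝕜] E)‖ < 1) :
    Function.Bijective (fun x => e x + P x) := by
  have hnorm : ‖-P.comp (e.symm : F →L[𝕜] E)‖ < 1 := by
    rw [norm_neg]
    exact (P.opNorm_comp_le _).trans_lt h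
  have hbij := ContinuousLinearMap.isUnit_iff_bijective.mp (isUnit_one_sub_of_norm_lt_one hnorm)
  convert hbij.comp e.bijective using 1
  ext x
  simp

/-- in the approximation setting, if `q* < 1` then
`K̂⁻¹(Z × X_h) ⊆ Q × X_h`, and for all data `(F_B, F)` the approximate problem has a
unique solution `(x_h, U_h)`, which moreover satisfies `U_h ∈ X_h`. -/
theorem stmt_8
    {Q X Y Z : Type*}
    [NormedAddCommGroup Q] [NormedSpace ℝ Q] [CompleteSpace Q]
    [NormedAddCommGroup X] [NormedSpace ℝ X] [CompleteSpace X]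
    [NormedAddCommGroup Y] [NormedSpace ℝ Y] [CompleteSpace Y]
    [NormedAddCommGroup Z] [NormedSpace ℝ Z] [CompleteSpace Z]
    (T : Y ≃L[ℝ] X) (G : Q × X →L[ℝ] Y) (B : Q × X →L[ℝ] Z)
    (Xh : Submodule ℝ X) (hXh : IsClosed (Xh : Set X))
    (Th : Y →L[ℝ] X) (hTh : ∀ y : Y, Th y ∈ Xh)
    (Ahat : (Q × X) ≃L[ℝ] (Z × X))
    (hAhat : ∀ p : Q × X, Ahat p = (B p, p.2 - T (G p)))
    (hq : ‖((T : Y →L[ℝ] X) - Th).comp G‖ *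
        ‖(Ahat.symm : (Z × X) →L[ℝ] (Q × X))‖ < 1) :
    (∀ p : Q × X, p.2 - Th (G p) ∈ Xh → p.2 ∈ Xh) ∧
      ∀ (FB : Z) (F : Y),
        (∃! p : Q × X, B p = FB ∧ p.2 - Th (G p) = Th F) ∧
        ∀ p : Q × X, (B p = FB ∧ p.2 - Th (G p) = Th F) → p.2 ∈ Xh := by
  have hmem : ∀ p : Q × X, p.2 - Th (G p) ∈ Xh → p.2 ∈ Xh := fun p hp => by
    simpa using Xh.add_mem hp (hTh (G p))
  refine ⟨hmem, fun FB F => ⟨?_, fun p hp => hmem p (hp.2 ▸ hTh F)⟩⟩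
  set D := ((T : Y →L[ℝ] X) - Th).comp G with hD
  have hnorm : ‖(ContinuousLinearMap.inr ℝ Z X).comp D‖ ≤ ‖D‖ :=
    ContinuousLinearMap.opNorm_le_bound _ (norm_nonneg _) fun p => by
      simpa [Prod.norm_def] using D.le_opNorm p
  have hbij := Ahat.bijective_add_of_norm_mul_lt_one ((ContinuousLinearMap.inr ℝ Z X).comp D)
    ((mul_le_mul_of_nonneg_right hnorm (norm_nonneg _)).trans_lt hq)
  simpa [hAhat, hD, Prod.ext_iff] using hbij.existsUnique (FB, Th F)
end

section
/- In the approximation setting, assume q* := ‖(T − T_h) ∘ G‖_{L(Γ,X)} · ‖Â⁻¹‖_{L(Δ,Γ)} < 1. Let (F_B, F) ∈ Z × Y, let (x,U) ∈ Q × X solve the exact problem and let (x_h,U_h) ∈ Q × X solve the approximate problem with the same data. Then ‖(x,U) − (x_h,U_h)‖_Γ ≤ (1 − q*)⁻¹ · ‖Â⁻¹‖_{L(Δ,Γ)} · ‖(T − T_h)(T⁻¹(U))‖_X. -/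
/-- error estimate between the exact solution `(x,U)` and the approximate
solution `(x_h,U_h)`:
`‖(x,U) − (x_h,U_h)‖_Γ ≤ (1 − q*)⁻¹ · ‖Â⁻¹‖ · ‖(T − T_h)(T⁻¹ U)‖`. -/
theorem stmt_9
    {Q X Y Z : Type*}
    [NormedAddCommGroup Q] [NormedSpace ℝ Q] [CompleteSpace Q]
    [NormedAddCommGroup X] [NormedSpace ℝ X] [CompleteSpace X]
    [NormedAddCommGroup Y] [NormedSpace ℝ Y] [CompleteSpace Y]
    [NormedAddCommGroup Z] [NormedSpace ℝ Z] [CompleteSpace Z]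
    (T : Y ≃L[ℝ] X) (G : Q × X →L[ℝ] Y) (B : Q × X →L[ℝ] Z)
    (Xh : Submodule ℝ X) (hXh : IsClosed (Xh : Set X))
    (Th : Y →L[ℝ] X) (hTh : ∀ y : Y, Th y ∈ Xh)
    (Ahat : (Q × X) ≃L[ℝ] (Z × X))
    (hAhat : ∀ p : Q × X, Ahat p = (B p, p.2 - T (G p)))
    (hq : ‖((T : Y →L[ℝ] X) - Th).comp G‖ *
        ‖(Ahat.symm : (Z × X) →L[ℝ] (Q × X))‖ < 1)
    (FB : Z) (F : Y) (p ph : Q × X)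
    (hp : B p = FB ∧ p.2 - T (G p) = T F)
    (hph : B ph = FB ∧ ph.2 - Th (G ph) = Th F) :
    ‖p - ph‖ ≤
      (1 - ‖((T : Y →L[ℝ] X) - Th).comp G‖ *
          ‖(Ahat.symm : (Z × X) →L[ℝ] (Q × X))‖)⁻¹ *
        ‖(Ahat.symm : (Z × X) →L[ℝ] (Q × X))‖ *
        ‖((T : Y →L[ℝ] X) - Th) (T.symm p.2)‖ := by
  set D : Y →L[ℝ] X := (T : Y →L[ℝ] X) - Th with hD
  set S : (Z × X) →L[ℝ] (Q × X) := (Ahat.symm : (Z × X) →L[ℝ] (Q × X)) with hS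
  obtain ⟨hpB, hpT⟩ := hp
  obtain ⟨hphB, hphT⟩ := hph
  have hDy : ∀ y, D y = T y - Th y := fun y => by simp [hD]
  have hU : T.symm p.2 = G p + F := by
    rw [T.symm_apply_eq, map_add, ← hpT]
    abel
  have hres : Ahat (p - ph) = (0, D (T.symm p.2) - D.comp G (p - ph)) := by
    rw [hAhat]
    refine Prod.ext ?_ ?_
    · simp [hpB, hphB]
    · have h₁ : p.2 = T F + T (G p) := sub_eq_iff_eq_add.mp hpT
      have h₂ : ph.2 = Th F + Th (G ph) := sub_eq_iff_eq_add.mp hphT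
      rw [hU]
      simp only [Prod.snd_sub, ContinuousLinearMap.comp_apply, hDy, map_sub, map_add, h₁, h₂]
      abel
  have herr : p - ph = S (0, D (T.symm p.2) - D.comp G (p - ph)) := by
    rw [← hres]
    simp [hS]
  have hbound : ‖p - ph‖ ≤ ‖S‖ * (‖D (T.symm p.2)‖ + ‖D.comp G‖ * ‖p - ph‖) := by
    calc ‖p - ph‖ = ‖S (0, D (T.symm p.2) - D.comp G (p - ph))‖ := congrArg norm herr
      _ ≤ ‖S‖ * ‖((0 : Z), D (T.symm p.2) - D.comp G (p - ph))‖ := S.le_opNorm _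
      _ = ‖S‖ * ‖D (T.symm p.2) - D.comp G (p - ph)‖ := by simp [Prod.norm_def]
      _ ≤ ‖S‖ * (‖D (T.symm p.2)‖ + ‖D.comp G‖ * ‖p - ph‖) := by
        gcongr
        exact (norm_sub_le _ _).trans (add_le_add_right ((D.comp G).le_opNorm _) _)
  rw [mul_assoc, ← div_eq_inv_mul, le_div_iff₀ (sub_pos.mpr hq)]
  linarith
end

section
/- In the approximation setting, let (X_n) be a sequence of closed linear subspaces of X and let (T_n) be a sequence of continuous linear maps T_n : Y → X, the range of T_n being contained in X_n, such that ‖T − T_n‖_{L(Y,X)} → 0 as n → ∞. Set q*_n := ‖(T − T_n) ∘ G‖_{L(Γ,X)} · ‖Â⁻¹‖_{L(Δ,Γ)}. Then there exists N such that q*_n < 1 for all n ≥ N; moreover, for fixed data (F_B, F) ∈ Z × Y, with (x,U) the exact solution and, for n ≥ N, (x_n,U_n) the unique solution of the n-th approximate problem, one has ‖U − U_n‖_X → 0 and ‖x − x_n‖_Q → 0 as n → ∞. -/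
theorem existsUnique_add_apply_eq {E : Type*} [NormedAddCommGroup E] [NormedSpace ℝ E]
    [CompleteSpace E] (K : E →L[ℝ] E) (hK : ‖K‖ < 1) (b : E) : ∃! p : E, p + K p = b := by
  obtain ⟨u, hu⟩ : IsUnit (1 - (-K)) :=
    isUnit_one_sub_of_norm_lt_one (by rwa [norm_neg])
  have happ : ∀ p, (u : E →L[ℝ] E) p = p + K p := fun p => by simp [hu]
  refine ⟨(↑u⁻¹ : E →L[ℝ] E) b, ?_, fun q hq => ?_⟩
  · change _ + K _ = b
    rw [← happ, ← mul_apply_eq_comp, Units.mul_inv, one_apply_eq_self]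
  · change q + K q = b at hq
    rw [← hq, ← happ, ← mul_apply_eq_comp, Units.inv_mul,
      one_apply_eq_self]

section PerturbedEquation

variable {Q X Y Z : Type*}
  [NormedAddCommGroup Q] [NormedSpace ℝ Q] [NormedAddCommGroup X] [NormedSpace ℝ X]
  [NormedAddCommGroup Y] [NormedSpace ℝ Y] [NormedAddCommGroup Z] [NormedSpace ℝ Z]

theorem approx_iff_add_symm_eq (T T' : Y →L[ℝ] X) (G : Q × X →L[ℝ] Y) (B : Q × X →L[ℝ] Z)
    (Ahat : (Q × X) ≃L[ℝ] (Z × X)) (hAhat : ∀ p : Q × X, Ahat p = (B p, p.2 - T (G p)))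
    (p : Q × X) (z : Z) (v : X) :
    (B p = z ∧ p.2 - T' (G p) = v) ↔
      p + Ahat.symm (0, (T - T') (G p)) = Ahat.symm (z, v) := by
  rw [← Ahat.injective.eq_iff, map_add, Ahat.apply_symm_apply, Ahat.apply_symm_apply, hAhat,
    Prod.mk_add_mk, Prod.mk.injEq, add_zero, sub_apply,
    sub_add_sub_cancel]

theorem norm_apply_inr_le (S : Z × X →L[ℝ] Q × X) (x : X) : ‖S (0, x)‖ ≤ ‖S‖ * ‖x‖ :=
  (S.le_opNorm _).trans_eq (by simp [Prod.norm_def])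

end PerturbedEquation

/-- if `‖T − T_n‖ → 0`, then eventually `q*_n < 1`; moreover for fixed
data the solutions of the approximate problems converge to the exact solution. -/
theorem stmt_12
    {Q X Y Z : Type*}
    [NormedAddCommGroup Q] [NormedSpace ℝ Q] [CompleteSpace Q]
    [NormedAddCommGroup X] [NormedSpace ℝ X] [CompleteSpace X]
    [NormedAddCommGroup Y] [NormedSpace ℝ Y] [CompleteSpace Y]
    [NormedAddCommGroup Z] [NormedSpace ℝ Z] [CompleteSpace Z]
    (T : Y ≃L[ℝ] X) (G : Q × X →L[ℝ] Y) (B : Q × X →L[ℝ] Z)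
    (Ahat : (Q × X) ≃L[ℝ] (Z × X))
    (hAhat : ∀ p : Q × X, Ahat p = (B p, p.2 - T (G p)))
    (Xn : ℕ → Submodule ℝ X) (hXn : ∀ n, IsClosed ((Xn n : Set X)))
    (Tn : ℕ → (Y →L[ℝ] X)) (hTn : ∀ n (y : Y), Tn n y ∈ Xn n)
    (hconv : Filter.Tendsto (fun n => ‖(T : Y →L[ℝ] X) - Tn n‖)
      Filter.atTop (nhds 0)) :
    ∃ N : ℕ,
      (∀ n, N ≤ n →
        ‖((T : Y →L[ℝ] X) - Tn n).comp G‖ *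
          ‖(Ahat.symm : (Z × X) →L[ℝ] (Q × X))‖ < 1) ∧
      ∀ (FB : Z) (F : Y),
        (∀ n, N ≤ n → ∃! p : Q × X, B p = FB ∧ p.2 - Tn n (G p) = Tn n F) ∧
        ∀ (p : Q × X) (pn : ℕ → Q × X),
          (B p = FB ∧ p.2 - T (G p) = T F) →
          (∀ n, N ≤ n → B (pn n) = FB ∧ (pn n).2 - Tn n (G (pn n)) = Tn n F) →
          Filter.Tendsto (fun n => ‖p.2 - (pn n).2‖) Filter.atTop (nhds 0) ∧
          Filter.Tendsto (fun n => ‖p.1 - (pn n).1‖) Filter.atTop (nhds 0) := by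
  have hq : Filter.Tendsto (fun n => ‖(T : Y →L[ℝ] X) - Tn n‖ * ‖G‖ *
      ‖(Ahat.symm : (Z × X) →L[ℝ] (Q × X))‖) Filter.atTop (nhds 0) := by
    simpa using (hconv.mul_const ‖G‖).mul_const ‖(Ahat.symm : (Z × X) →L[ℝ] (Q × X))‖
  obtain ⟨N, hN⟩ := Filter.eventually_atTop.1
    (hq.eventually_lt_const (show (0 : ℝ) < 1 / 2 by norm_num))
  have hqN : ∀ n, N ≤ n → ‖((T : Y →L[ℝ] X) - Tn n).comp G‖ *
      ‖(Ahat.symm : (Z × X) →L[ℝ] (Q × X))‖ < 1 / 2 := fun n hn =>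
    (mul_le_mul_of_nonneg_right (ContinuousLinearMap.opNorm_comp_le _ _)
      (norm_nonneg _)).trans_lt (hN n hn)
  have hbound : ∀ n (p : Q × X), ‖Ahat.symm (0, ((T : Y →L[ℝ] X) - Tn n) (G p))‖ ≤
      ‖((T : Y →L[ℝ] X) - Tn n).comp G‖ *
        ‖(Ahat.symm : (Z × X) →L[ℝ] (Q × X))‖ * ‖p‖ := fun n p => by
    refine (norm_apply_inr_le (Ahat.symm : (Z × X) →L[ℝ] (Q × X)) _).trans ?_
    rw [mul_comm ‖((T : Y →L[ℝ] X) - Tn n).comp G‖, mul_assoc]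
    exact mul_le_mul_of_nonneg_left
      ((((T : Y →L[ℝ] X) - Tn n).comp G).le_opNorm p) (norm_nonneg _)
  refine ⟨N, fun n hn => (hqN n hn).trans (by norm_num), fun FB F => ⟨fun n hn => ?_, ?_⟩⟩
  · simp only [approx_iff_add_symm_eq (T : Y →L[ℝ] X) (Tn n) G B Ahat hAhat]
    refine existsUnique_add_apply_eq
      (((Ahat.symm : (Z × X) →L[ℝ] (Q × X)).comp (ContinuousLinearMap.inr ℝ Z X)).comp
        (((T : Y →L[ℝ] X) - Tn n).comp G)) ?_ _
    exact (ContinuousLinearMap.opNorm_le_bound _ (by positivity) (hbound n)).trans_lt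
      ((hqN n hn).trans (by norm_num))
  · intro p pn hp hpn
    have hest : ∀ n, N ≤ n → ‖p - pn n‖ ≤ ‖(T : Y →L[ℝ] X) - Tn n‖ *
        (2 * ‖(Ahat.symm : (Z × X) →L[ℝ] (Q × X))‖ * ‖F + G p‖) := fun n hn => by
      have hdiff : B (p - pn n) = 0 ∧ (p - pn n).2 - Tn n (G (p - pn n)) =
          ((T : Y →L[ℝ] X) - Tn n) (F + G p) := by
        obtain ⟨h1, h2⟩ := hp
        obtain ⟨h3, h4⟩ := hpn n hn
        refine ⟨by rw [map_sub, h1, h3, sub_self], ?_⟩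
        simp only [Prod.snd_sub, map_sub, map_add, sub_apply,
          ContinuousLinearEquiv.coe_coe, ← h2, ← h4]
        abel
      rw [approx_iff_add_symm_eq (T : Y →L[ℝ] X) (Tn n) G B Ahat hAhat,
        ← eq_sub_iff_add_eq] at hdiff
      have h1 := (congrArg norm hdiff).le.trans (norm_sub_le _ _)
      have h2 := norm_apply_inr_le (Ahat.symm : (Z × X) →L[ℝ] (Q × X))
        (((T : Y →L[ℝ] X) - Tn n) (F + G p))
      have h3 := mul_le_mul_of_nonneg_left (((T : Y →L[ℝ] X) - Tn n).le_opNorm (F + G p))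
        (norm_nonneg (Ahat.symm : (Z × X) →L[ℝ] (Q × X)))
      have h4 := (hbound n (p - pn n)).trans
        (mul_le_mul_of_nonneg_right (hqN n hn).le (norm_nonneg _))
      rw [ContinuousLinearEquiv.coe_coe] at h2
      linarith
    have hlim : Filter.Tendsto (fun n => ‖p - pn n‖) Filter.atTop (nhds 0) := by
      refine squeeze_zero' (Filter.Eventually.of_forall fun n => norm_nonneg _)
        (Filter.eventually_atTop.2 ⟨N, hest⟩) ?_
      simpa using hconv.mul_const
        (2 * ‖(Ahat.symm : (Z × X) →L[ℝ] (Q × X))‖ * ‖F + G p‖)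
    exact ⟨squeeze_zero (fun n => norm_nonneg _) (fun n => norm_snd_le (p - pn n)) hlim,
      squeeze_zero (fun n => norm_nonneg _) (fun n => norm_fst_le (p - pn n)) hlim⟩
end
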